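/- arXiv:2503.07626 — 3 statements merged into one kernel-verified Lean document; each statement's English description precedes it below -/
import Mathlib

section
/- Let g ∈ Sp(2n, ℝ) be written in n×n blocks as g = [[A, B], [C, D]], and let Z be a complex symmetric n×n matrix with Im Z positive definite. Then (regarding A, B, C, D as complex matrices) the matrix C·Z + D is invertible, the matrix Z' := (A·Z + B)·(C·Z + D)⁻¹ is symmetric, and Im Z' is positive definite. Hence the fractional linear matrix action of Sp(2n, ℝ) preserves the Siegel upper half-space of degree n. -/
open Matrix
open scoped ComplexOrder

open scoped MatrixOrder in
lemma posDef_map_ofReal {n : ℕ} {Y : Matrix (Fin n) (Fin n) ℝ} (hY : Y.PosDef) :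
    (Y.map Complex.ofReal).PosDef := by
  obtain ⟨B, hB⟩ := CStarAlgebra.nonneg_iff_eq_star_mul_self.1 hY.posSemidef.nonneg
  have hu : IsUnit B := by
    have h := hY.isUnit
    rw [hB, Matrix.isUnit_iff_isUnit_det, det_mul] at h
    rw [Matrix.isUnit_iff_isUnit_det]
    exact isUnit_of_mul_isUnit_right h
  have hu' : IsUnit (B.map Complex.ofReal) :=
    hu.map (Complex.ofRealHom.mapMatrix (m := Fin n))
  have hc : (B.map Complex.ofReal)ᴴ * B.map Complex.ofReal = Y.map Complex.ofReal := by
    ext i j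
    rw [hB]
    simp [mul_apply]
  rw [← hc]
  exact PosDef.conjTranspose_mul_self _ (mulVec_injective_iff_isUnit.2 hu')

lemma posDef_of_map_ofReal {n : ℕ} {Y : Matrix (Fin n) (Fin n) ℝ}
    (hY : (Y.map Complex.ofReal).PosDef) : Y.PosDef := by
  refine PosDef.of_dotProduct_mulVec_pos ?_ ?_
  · ext i j
    have := congrFun (congrFun hY.1 i) j
    simpa using this
  · intro x hx
    have hx' : (fun i => (x i : ℂ)) ≠ 0 := by
      intro h
      apply hx
      funext i
      simpa using congrFun h i
    have h := hY.dotProduct_mulVec_pos hx'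
    have e : star (fun i => (x i : ℂ)) ⬝ᵥ (Y.map Complex.ofReal *ᵥ (fun i => (x i : ℂ)))
        = ((star x ⬝ᵥ (Y *ᵥ x) : ℝ) : ℂ) := by
      simp [dotProduct, mulVec]
    rw [e] at h
    exact_mod_cast h

lemma sub_conjTranspose_of_symm {n : ℕ} {Z : Matrix (Fin n) (Fin n) ℂ} (hZ : Zᵀ = Z) :
    Z - Zᴴ = (2 * Complex.I) • (Z.map Complex.im).map Complex.ofReal := by
  ext i j
  have h : Z j i = Z i j := congrFun (congrFun hZ i) j
  simp only [Matrix.sub_apply, conjTranspose_apply, h, Matrix.smul_apply, map_apply, smul_eq_mul]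
  apply Complex.ext <;> simp
  ring

/-- **The symplectic group acts on the Siegel upper half-space.**
If `g = [[A,B],[C,D]] ∈ Sp(2n,ℝ)` and `Z` is a complex symmetric `n×n` matrix with
positive definite imaginary part, then `C·Z + D` is invertible,
`Z' = (A·Z + B)·(C·Z + D)⁻¹` is symmetric, and `Im Z'` is positive definite. -/
theorem stmt_1 (n : ℕ) (hn : 0 < n)
    (A B C D : Matrix (Fin n) (Fin n) ℝ)
    (hsymp : (fromBlocks A B C D)ᵀ * fromBlocks 0 1 (-1) 0 * fromBlocks A B C D
      = fromBlocks 0 1 (-1) 0)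
    (Z : Matrix (Fin n) (Fin n) ℂ) (hZsym : Zᵀ = Z)
    (hZim : (Z.map Complex.im).PosDef) :
    IsUnit (C.map Complex.ofReal * Z + D.map Complex.ofReal) ∧
    ((A.map Complex.ofReal * Z + B.map Complex.ofReal) *
        (C.map Complex.ofReal * Z + D.map Complex.ofReal)⁻¹)ᵀ =
      (A.map Complex.ofReal * Z + B.map Complex.ofReal) *
        (C.map Complex.ofReal * Z + D.map Complex.ofReal)⁻¹ ∧
    (((A.map Complex.ofReal * Z + B.map Complex.ofReal) *
        (C.map Complex.ofReal * Z + D.map Complex.ofReal)⁻¹).map Complex.im).PosDef := by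
  obtain ⟨h1, h2, h3⟩ := SymplecticGroup.fromBlocks_mem_iff.1
    ((SymplecticGroup.transpose_mem_iff (l := Fin n) (R := ℝ)
      (A := fromBlocks A B C D)).1 (by
        have hs : -((fromBlocks A B C D)ᵀ * fromBlocks 0 1 (-1) 0 * fromBlocks A B C D)
          = -fromBlocks 0 1 (-1) 0 := by rw [hsymp]
        rw [SymplecticGroup.mem_iff, transpose_transpose, J]
        rw [← neg_mul, ← mul_neg] at hs
        simpa [fromBlocks_neg] using hs))
  have t : ∀ M N : Matrix (Fin n) (Fin n) ℝ,
      (M * N).map Complex.ofReal = M.map Complex.ofReal * N.map Complex.ofReal :=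
    fun M N => Matrix.map_mul (f := Complex.ofRealHom)
  have tt : ∀ M : Matrix (Fin n) (Fin n) ℝ,
      (M.map Complex.ofReal)ᵀ = Mᵀ.map Complex.ofReal := fun M => rfl
  have c1 := congrArg (fun M => M.map Complex.ofReal) h1
  have c2 := congrArg (fun M => M.map Complex.ofReal) h2
  have c3 : (Aᵀ * D).map Complex.ofReal - (Cᵀ * B).map Complex.ofReal = 1 := by
    have := congrArg (Complex.ofRealHom.mapMatrix (m := Fin n)) h3
    rwa [map_sub, map_one] at this
  simp only [t, ← tt] at c1 c2 c3
  have k : ∀ M : Matrix (Fin n) (Fin n) ℝ,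
      (M.map Complex.ofReal)ᴴ = (M.map Complex.ofReal)ᵀ := by
    intro M; ext i j; simp
  have kA := k A
  have kB := k B
  have kC := k C
  have kD := k D
  generalize A.map Complex.ofReal = a at *
  generalize B.map Complex.ofReal = b at *
  generalize C.map Complex.ofReal = c at *
  generalize D.map Complex.ofReal = d at *
  have c4 : dᵀ * a - bᵀ * c = 1 := by simpa using congrArg transpose c3
  have e1 : (a * Z + b)ᵀ * (c * Z + d) = (c * Z + d)ᵀ * (a * Z + b) := by
    have : (a * Z + b)ᵀ * (c * Z + d) - (c * Z + d)ᵀ * (a * Z + b)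
      = Z * (aᵀ * c - cᵀ * a) * Z + Z * (aᵀ * d - cᵀ * b)
        - (dᵀ * a - bᵀ * c) * Z + (bᵀ * d - dᵀ * b) := by
      simp only [transpose_add, transpose_mul, hZsym]
      noncomm_ring
    rw [c1, c2, c3, c4] at this
    exact sub_eq_zero.1 (by rw [this]; simp)
  have e2 : (c * Z + d)ᴴ * (a * Z + b) - (a * Z + b)ᴴ * (c * Z + d) = Z - Zᴴ := by
    have : (c * Z + d)ᴴ * (a * Z + b) - (a * Z + b)ᴴ * (c * Z + d)
      = (dᵀ * a - bᵀ * c) * Z - Zᴴ * (aᵀ * d - cᵀ * b)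
        - Zᴴ * (aᵀ * c - cᵀ * a) * Z - (bᵀ * d - dᵀ * b) := by
      simp only [conjTranspose_add, conjTranspose_mul, kA, kB, kC, kD]
      noncomm_ring
    rw [c1, c2, c3, c4] at this
    rw [this]; simp
  generalize a * Z + b = P at *
  generalize c * Z + d = Q at *
  have hY := posDef_map_ofReal hZim
  rw [sub_conjTranspose_of_symm hZsym] at e2
  generalize (Z.map Complex.im).map Complex.ofReal = Y at *
  have hI : (2 * Complex.I) ≠ 0 := by simp
  have hQ : IsUnit Q := by
    rw [← mulVec_injective_iff_isUnit]
    refine (injective_iff_map_eq_zero (Matrix.mulVecLin Q)).2 ?_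
    intro x hx
    rw [mulVecLin_apply] at hx
    by_contra hx0
    have hp := hY.dotProduct_mulVec_pos hx0
    have h0 : star x ⬝ᵥ ((Qᴴ * P - Pᴴ * Q) *ᵥ x) = 0 := by
      rw [sub_mulVec, ← mulVec_mulVec, ← mulVec_mulVec, hx, dotProduct_sub,
        dotProduct_mulVec, ← star_mulVec, hx]
      simp
    rw [e2, smul_mulVec, dotProduct_smul, smul_eq_mul] at h0
    exact hp.ne' ((mul_eq_zero.1 h0).resolve_left hI)
  have hdet : IsUnit Q.det := (isUnit_iff_isUnit_det _).1 hQ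
  have hQQ : Q * Q⁻¹ = 1 := mul_nonsing_inv _ hdet
  have hT : Q⁻¹ᵀ * Qᵀ = 1 := by rw [← transpose_mul, hQQ, transpose_one]
  have hH : Q⁻¹ᴴ * Qᴴ = 1 := by rw [← conjTranspose_mul, hQQ, conjTranspose_one]
  have hsym : (P * Q⁻¹)ᵀ = P * Q⁻¹ := by
    calc (P * Q⁻¹)ᵀ = Q⁻¹ᵀ * (Pᵀ * Q) * Q⁻¹ := by
          rw [transpose_mul, Matrix.mul_assoc, Matrix.mul_assoc, hQQ, Matrix.mul_one]
      _ = (Q⁻¹ᵀ * Qᵀ) * (P * Q⁻¹) := by rw [e1]; simp only [Matrix.mul_assoc]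
      _ = P * Q⁻¹ := by rw [hT, Matrix.one_mul]
  refine ⟨hQ, hsym, posDef_of_map_ofReal ?_⟩
  have hW : P * Q⁻¹ - (P * Q⁻¹)ᴴ = (2 * Complex.I) • (Q⁻¹ᴴ * Y * Q⁻¹) := by
    calc P * Q⁻¹ - (P * Q⁻¹)ᴴ
        = (Q⁻¹ᴴ * Qᴴ) * (P * Q⁻¹) - Q⁻¹ᴴ * Pᴴ * (Q * Q⁻¹) := by
          rw [hH, hQQ, Matrix.one_mul, Matrix.mul_one, conjTranspose_mul]
      _ = Q⁻¹ᴴ * (Qᴴ * P - Pᴴ * Q) * Q⁻¹ := by noncomm_ring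
      _ = _ := by rw [e2]; simp
  rw [sub_conjTranspose_of_symm hsym] at hW
  rw [smul_right_injective _ hI hW]
  exact hY.conjTranspose_mul_mul_same
    (mulVec_injective_iff_isUnit.2 ((isUnit_nonsing_inv_iff).2 hQ))
end

section
/- (i) For all ρ, ρ', p, q ∈ ℝ one has 𝔏(ρ',p,q)·𝔑(ρ)·𝔏(ρ',p,q)⁻¹ = 𝔑(ρ), i.e. 𝔑(ρ) is central in the Heisenberg-type group {𝔏(ρ,p,q)}. (ii) For all w₁,…,w₆ ∈ ℝ and ρ ∈ ℝ one has L_TS(w)·𝔑(ρ)·L_TS(w)⁻¹ = 𝔑(e^(w₁+w₂)·ρ); in particular the one-parameter group {𝔑(ρ) : ρ ∈ ℝ} is a normal subgroup both of the Heisenberg-type group {𝔏(ρ,p,q)} and of the Tits-Satake solvable group formed by the matrices L_TS(w). -/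
open Matrix

/-- The `6×6` matrix `𝔑(ρ) = I₆ + ρ·(E₁₅ − E₂₆)`. -/
def frakN (ρ : ℝ) : Matrix (Fin 6) (Fin 6) ℝ :=
  !![1, 0, 0, 0, ρ, 0;
     0, 1, 0, 0, 0, -ρ;
     0, 0, 1, 0, 0, 0;
     0, 0, 0, 1, 0, 0;
     0, 0, 0, 0, 1, 0;
     0, 0, 0, 0, 0, 1]

/-- The `6×6` matrix `𝔏(ρ,p,q)`: the identity except for the entries
`𝔏₁₄ = 2p`, `𝔏₁₅ = ρ − 4pq`, `𝔏₁₆ = −2p²`, `𝔏₂₄ = 2q`, `𝔏₂₅ = −2q²`, `𝔏₂₆ = −ρ`,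
`𝔏₄₅ = −2q`, `𝔏₄₆ = −2p`. -/
def frakL (ρ p q : ℝ) : Matrix (Fin 6) (Fin 6) ℝ :=
  !![1, 0, 0, 2 * p, ρ - 4 * p * q, -2 * p ^ 2;
     0, 1, 0, 2 * q, -2 * q ^ 2, -ρ;
     0, 0, 1, 0, 0, 0;
     0, 0, 0, 1, -2 * q, -2 * p;
     0, 0, 0, 0, 1, 0;
     0, 0, 0, 0, 0, 1]

/-- The Tits-Satake solvable coset representative `L_TS(w)`, `w = (w₁,…,w₆) ∈ ℝ⁶`. -/
noncomputable def LTS (w₁ w₂ w₃ w₄ w₅ w₆ : ℝ) : Matrix (Fin 6) (Fin 6) ℝ :=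
  !![Real.exp w₁, Real.exp w₁ * w₃ / Real.sqrt 2,
      (1 / 2) * Real.exp w₁ * (Real.sqrt 2 * w₅ + w₃ * w₆), 0,
      Real.exp w₁ * (-(w₃ * w₆ ^ 2) / (4 * Real.sqrt 2) - w₅ * w₆ / 2 + w₄ / Real.sqrt 2),
      -(1 / 2) * Real.exp w₁ * (w₅ ^ 2 / 2 + w₃ * w₄);
     0, Real.exp w₂, Real.exp w₂ * w₆ / Real.sqrt 2, 0,
      -(1 / 4) * Real.exp w₂ * w₆ ^ 2, -(Real.exp w₂ * w₄ / Real.sqrt 2);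
     0, 0, 1, 0, -(w₆ / Real.sqrt 2), -(w₅ / Real.sqrt 2);
     0, 0, 0, 1, 0, 0;
     0, 0, 0, 0, Real.exp (-w₂), -(Real.exp (-w₂) * w₃ / Real.sqrt 2);
     0, 0, 0, 0, 0, Real.exp (-w₁)]

lemma frakL_isUnit_det (ρ p q : ℝ) : IsUnit (frakL ρ p q).det := by
  have ht : (frakL ρ p q).BlockTriangular id := by
    intro i j hij
    fin_cases i <;> fin_cases j <;> simp_all [frakL]
  rw [Matrix.det_of_upperTriangular ht]
  simp [Fin.prod_univ_succ, frakL]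

lemma LTS_isUnit_det (w₁ w₂ w₃ w₄ w₅ w₆ : ℝ) : IsUnit (LTS w₁ w₂ w₃ w₄ w₅ w₆).det := by
  have ht : (LTS w₁ w₂ w₃ w₄ w₅ w₆).BlockTriangular id := by
    intro i j hij
    fin_cases i <;> fin_cases j <;> simp_all [LTS]
  rw [Matrix.det_of_upperTriangular ht]
  simp [Fin.prod_univ_succ, LTS]

lemma frakL_comm (ρ ρ' p q : ℝ) : frakL ρ' p q * frakN ρ = frakN ρ * frakL ρ' p q := by
  ext i j
  fin_cases i <;> fin_cases j <;>
    simp [frakL, frakN, Matrix.mul_apply, Fin.sum_univ_succ] <;> ring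

lemma LTS_comm (ρ w₁ w₂ w₃ w₄ w₅ w₆ : ℝ) :
    LTS w₁ w₂ w₃ w₄ w₅ w₆ * frakN ρ =
      frakN (Real.exp (w₁ + w₂) * ρ) * LTS w₁ w₂ w₃ w₄ w₅ w₆ := by
  ext i j
  fin_cases i <;> fin_cases j <;>
    simp [LTS, frakN, Matrix.mul_apply, Fin.sum_univ_succ, Real.exp_add, Real.exp_neg] <;>
    field_simp <;> ring

/-- **`{𝔑(ρ)}` is a normal one-parameter subgroup.**
(i) `𝔏(ρ',p,q)·𝔑(ρ)·𝔏(ρ',p,q)⁻¹ = 𝔑(ρ)` (so `𝔑(ρ)` is central in the Heisenberg-type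
group); (ii) `L_TS(w)·𝔑(ρ)·L_TS(w)⁻¹ = 𝔑(e^{w₁+w₂}·ρ)`; in particular `{𝔑(ρ)}` is a
normal subgroup both of `{𝔏(ρ,p,q)}` and of the Tits-Satake solvable group. -/
theorem stmt_11 (ρ ρ' p q w₁ w₂ w₃ w₄ w₅ w₆ : ℝ) :
    frakL ρ' p q * frakN ρ * (frakL ρ' p q)⁻¹ = frakN ρ ∧
    LTS w₁ w₂ w₃ w₄ w₅ w₆ * frakN ρ * (LTS w₁ w₂ w₃ w₄ w₅ w₆)⁻¹ =
      frakN (Real.exp (w₁ + w₂) * ρ) := by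
  refine ⟨?_, ?_⟩
  · rw [frakL_comm, Matrix.mul_nonsing_inv_cancel_right _ _ (frakL_isUnit_det ρ' p q)]
  · rw [LTS_comm, Matrix.mul_nonsing_inv_cancel_right _ _ (LTS_isUnit_det w₁ w₂ w₃ w₄ w₅ w₆)]
end

section
/- Each of the four matrices J₁₂⁺, J₁₂⁻, J₁, J₂ satisfies Mᵀ·η₅·M = η₅ (so they lie in the integral orthogonal group of the form η₅ of signature (2,3)); one has J₁² = J₂² = I₅ and (J₁₂⁺)⁴ = (J₁₂⁻)⁴ = I₅; and the subgroup of GL(5,ℤ) generated by {J₁₂⁺, J₁₂⁻, J₁, J₂} (the generalized Weyl group of SO(2,3)) is finite of order exactly 16. -/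
open Matrix

/-- The diagonal form `η₅ = diag(1,1,−1,−1,−1)` of signature `(2,3)`. -/
def eta5Z : Matrix (Fin 5) (Fin 5) ℤ :=
  !![1, 0, 0, 0, 0; 0, 1, 0, 0, 0; 0, 0, -1, 0, 0; 0, 0, 0, -1, 0; 0, 0, 0, 0, -1]

/-- The generalized Weyl generator `J₁₂⁺`. -/
def J₁₂p : Matrix (Fin 5) (Fin 5) ℤ :=
  !![0, -1, 0, 0, 0; 1, 0, 0, 0, 0; 0, 0, 0, 1, 0; 0, 0, -1, 0, 0; 0, 0, 0, 0, 1]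

/-- The generalized Weyl generator `J₁₂⁻`. -/
def J₁₂m : Matrix (Fin 5) (Fin 5) ℤ :=
  !![0, -1, 0, 0, 0; 1, 0, 0, 0, 0; 0, 0, 0, -1, 0; 0, 0, 1, 0, 0; 0, 0, 0, 0, 1]

/-- The generalized Weyl generator `J₁ = diag(1,1,−1,1,−1)`. -/
def J₁ : Matrix (Fin 5) (Fin 5) ℤ :=
  !![1, 0, 0, 0, 0; 0, 1, 0, 0, 0; 0, 0, -1, 0, 0; 0, 0, 0, 1, 0; 0, 0, 0, 0, -1]

/-- The generalized Weyl generator `J₂ = diag(1,1,1,−1,−1)`. -/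
def J₂ : Matrix (Fin 5) (Fin 5) ℤ :=
  !![1, 0, 0, 0, 0; 0, 1, 0, 0, 0; 0, 0, 1, 0, 0; 0, 0, 0, -1, 0; 0, 0, 0, 0, -1]

/-- Normal form of the elements of the group. -/
def weylNF (p : Fin 4 × Fin 2 × Fin 2) : Matrix (Fin 5) (Fin 5) ℤ :=
  J₁₂p ^ (p.1 : ℕ) * (J₁ ^ (p.2.1 : ℕ) * J₂ ^ (p.2.2 : ℕ))

lemma weylNF_inj : Function.Injective weylNF := by
  have h : ∀ p q, weylNF p = weylNF q → p = q := by decide +kernel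
  exact fun p q => h p q

lemma weylNF_p : ∀ p, ∃ q, weylNF q = J₁₂p * weylNF p := by decide +kernel
lemma weylNF_m : ∀ p, ∃ q, weylNF q = J₁₂m * weylNF p := by decide +kernel
lemma weylNF_1 : ∀ p, ∃ q, weylNF q = J₁ * weylNF p := by decide +kernel
lemma weylNF_2 : ∀ p, ∃ q, weylNF q = J₂ * weylNF p := by decide +kernel
lemma weylNF_inv : ∀ p, ∃ q, weylNF p * weylNF q = 1 ∧ weylNF q * weylNF p = 1 := by
  decide +kernel

lemma weyl_closure :
    (Submonoid.closure ({J₁₂p, J₁₂m, J₁, J₂} : Set (Matrix (Fin 5) (Fin 5) ℤ)) :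
      Set (Matrix (Fin 5) (Fin 5) ℤ)) = Set.range weylNF := by
  ext x
  constructor
  · intro hx
    refine Submonoid.closure_induction_left (motive := fun x _ => x ∈ Set.range weylNF)
      ?_ ?_ hx
    · exact ⟨(0, 0, 0), by simp [weylNF]⟩
    · rintro g hg y _ ⟨p, rfl⟩
      rcases hg with rfl | rfl | rfl | rfl
      · exact weylNF_p p
      · exact weylNF_m p
      · exact weylNF_1 p
      · exact weylNF_2 p
  · rintro ⟨p, rfl⟩
    refine mul_mem (pow_mem (Submonoid.subset_closure ?_) _)
      (mul_mem (pow_mem (Submonoid.subset_closure ?_) _)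
        (pow_mem (Submonoid.subset_closure ?_) _)) <;> simp

/-- **The generalized Weyl group of `SO(2,3)` has order `16`.**
`J₁₂⁺, J₁₂⁻, J₁, J₂` lie in the integral orthogonal group of `η₅`; `J₁² = J₂² = I₅`,
`(J₁₂⁺)⁴ = (J₁₂⁻)⁴ = I₅`; and the subgroup of `GL(5,ℤ)` they generate (here the monoid
closure, a group since every element has a two-sided inverse in it) is finite of order
exactly `16`. -/
theorem stmt_17 :
    J₁₂pᵀ * eta5Z * J₁₂p = eta5Z ∧ J₁₂mᵀ * eta5Z * J₁₂m = eta5Z ∧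
    J₁ᵀ * eta5Z * J₁ = eta5Z ∧ J₂ᵀ * eta5Z * J₂ = eta5Z ∧
    J₁ ^ 2 = 1 ∧ J₂ ^ 2 = 1 ∧ J₁₂p ^ 4 = 1 ∧ J₁₂m ^ 4 = 1 ∧
    (∀ x ∈ Submonoid.closure ({J₁₂p, J₁₂m, J₁, J₂} : Set (Matrix (Fin 5) (Fin 5) ℤ)),
      ∃ y ∈ Submonoid.closure ({J₁₂p, J₁₂m, J₁, J₂} : Set (Matrix (Fin 5) (Fin 5) ℤ)),
        x * y = 1 ∧ y * x = 1) ∧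
    (Submonoid.closure ({J₁₂p, J₁₂m, J₁, J₂} : Set (Matrix (Fin 5) (Fin 5) ℤ)) :
      Set (Matrix (Fin 5) (Fin 5) ℤ)).Finite ∧
    Nat.card
      (Submonoid.closure ({J₁₂p, J₁₂m, J₁, J₂} : Set (Matrix (Fin 5) (Fin 5) ℤ))) = 16 := by
  refine ⟨by decide +kernel, by decide +kernel, by decide +kernel, by decide +kernel,
    by decide +kernel, by decide +kernel, by decide +kernel, by decide +kernel, ?_, ?_, ?_⟩
  · intro x hx
    rw [← SetLike.mem_coe, weyl_closure] at hx
    obtain ⟨p, rfl⟩ := hx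
    obtain ⟨q, hq⟩ := weylNF_inv p
    refine ⟨weylNF q, ?_, hq⟩
    rw [← SetLike.mem_coe, weyl_closure]
    exact ⟨q, rfl⟩
  · rw [weyl_closure]
    exact Set.finite_range _
  · rw [← SetLike.coe_sort_coe, weyl_closure, Nat.card_range_of_injective weylNF_inj]
    simp
end
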